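/- Let α > 0. There exists a constant C > 0, depending only on α, such that for every m ∈ ℤ², Σ_{l∈ℤ², |l| ≤ |m|/2} (1+|m−l|²)^{-α}·(1+|l|²)^{-1} ≤ C·(1+|m|²)^{-α}·log(2+|m|). -/

import Mathlib

open scoped BigOperators

/-- Squared Euclidean norm of a lattice point of `ℤ²`. -/
noncomputable def nsq (m : ℤ × ℤ) : ℝ := (m.1 : ℝ) ^ 2 + (m.2 : ℝ) ^ 2

/-- Euclidean norm of a lattice point of `ℤ²`. -/
noncomputable def norm2 (m : ℤ × ℤ) : ℝ := Real.sqrt (nsq m)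

theorem nsq_nonneg' (l : ℤ × ℤ) : 0 ≤ nsq l := by unfold nsq; positivity

theorem box_sum (N : ℕ) :
    ∑ n ∈ Finset.range (N + 1), ∑ l ∈ (Finset.box n : Finset (ℤ × ℤ)), (1 + nsq l)⁻¹
      ≤ 9 + 8 * Real.log N := by
  have key : ∀ n : ℕ, ∑ l ∈ (Finset.box (n + 1) : Finset (ℤ × ℤ)), (1 + nsq l)⁻¹
      ≤ 8 * ((n + 1 : ℕ) : ℝ)⁻¹ := by
    intro n
    have h1 : ∀ l ∈ (Finset.box (n + 1) : Finset (ℤ × ℤ)),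
        (1 + nsq l)⁻¹ ≤ (((n + 1 : ℕ) : ℝ) ^ 2)⁻¹ := by
      intro l hl
      rw [Int.mem_box] at hl
      apply inv_anti₀ (by positivity)
      unfold nsq
      have e1 : ((l.1.natAbs : ℕ) : ℝ) ^ 2 = (l.1 : ℝ) ^ 2 := by
        rw [Nat.cast_natAbs, Int.cast_abs, sq_abs]
      have e2 : ((l.2.natAbs : ℕ) : ℝ) ^ 2 = (l.2 : ℝ) ^ 2 := by
        rw [Nat.cast_natAbs, Int.cast_abs, sq_abs]
      rw [← hl]
      rcases max_choice l.1.natAbs l.2.natAbs with h | h <;> rw [h] <;>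
        nlinarith [sq_nonneg (l.1 : ℝ), sq_nonneg (l.2 : ℝ)]
    refine (Finset.sum_le_card_nsmul _ _ _ h1).trans ?_
    rw [Int.card_box (by omega), nsmul_eq_mul]
    apply le_of_eq
    push_cast
    field_simp
  rw [Finset.sum_range_succ']
  have h0 : ∑ l ∈ (Finset.box 0 : Finset (ℤ × ℤ)), (1 + nsq l)⁻¹ = 1 := by
    simp [nsq]
  rw [h0]
  have h2 := Finset.sum_le_sum (s := Finset.range N) (fun n _ => key n)
  rw [← Finset.mul_sum] at h2
  have h3 := harmonic_le_one_add_log N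
  have h4 : ((harmonic N : ℚ) : ℝ) = ∑ n ∈ Finset.range N, ((n + 1 : ℕ) : ℝ)⁻¹ := by
    simp [harmonic]
  rw [h4] at h3
  linarith

theorem ptwise (α : ℝ) (hα : 0 < α) (m l : ℤ × ℤ) (h : norm2 l ≤ norm2 m / 2) :
    (1 + nsq (m - l)) ^ (-α) ≤ 4 ^ α * (1 + nsq m) ^ (-α) := by
  have h4 : 4 * nsq l ≤ nsq m := by
    have := pow_le_pow_left₀ (Real.sqrt_nonneg _) h 2
    rw [div_pow] at this
    unfold norm2 at this
    rw [Real.sq_sqrt (nsq_nonneg' _), Real.sq_sqrt (nsq_nonneg' _)] at this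
    linarith
  have h5 : (1 + nsq m) / 4 ≤ 1 + nsq (m - l) := by
    -- |m|² = |(m-l)+l|² ≤ 2|m-l|² + 2|l|² ≤ 2|m-l|² + |m|²/2
    unfold nsq at *
    simp only [Prod.fst_sub, Prod.snd_sub, Int.cast_sub]
    nlinarith [sq_nonneg ((m.1 : ℝ) - 2 * l.1), sq_nonneg ((m.2 : ℝ) - 2 * l.2)]
  have hm : 0 < 1 + nsq m := by linarith [nsq_nonneg' m]
  calc (1 + nsq (m - l)) ^ (-α) ≤ ((1 + nsq m) / 4) ^ (-α) :=
        Real.rpow_le_rpow_of_nonpos (by positivity) h5 (by linarith)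
    _ = 4 ^ α * (1 + nsq m) ^ (-α) := by
        rw [Real.div_rpow hm.le (by norm_num), Real.rpow_neg (by norm_num : (0:ℝ) ≤ 4)]
        field_simp

theorem natAbs_le_norm2 (l : ℤ × ℤ) : ((max l.1.natAbs l.2.natAbs : ℕ) : ℝ) ≤ norm2 l := by
  unfold norm2
  apply Real.le_sqrt_of_sq_le
  unfold nsq
  have e1 : ((l.1.natAbs : ℕ) : ℝ) ^ 2 = (l.1 : ℝ) ^ 2 := by
    rw [Nat.cast_natAbs, Int.cast_abs, sq_abs]
  have e2 : ((l.2.natAbs : ℕ) : ℝ) ^ 2 = (l.2 : ℝ) ^ 2 := by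
    rw [Nat.cast_natAbs, Int.cast_abs, sq_abs]
  rcases max_choice l.1.natAbs l.2.natAbs with h | h <;> rw [h] <;>
    nlinarith [sq_nonneg (l.1 : ℝ), sq_nonneg (l.2 : ℝ)]

theorem stmt_3 (α : ℝ) (hα : 0 < α) :
    ∃ C : ℝ, 0 < C ∧
      ∀ m : ℤ × ℤ,
        (∑' l : ℤ × ℤ,
            Set.indicator {l : ℤ × ℤ | norm2 l ≤ norm2 m / 2}
              (fun l => (1 + nsq (m - l)) ^ (-α) * (1 + nsq l) ^ (-1 : ℝ)) l)
          ≤ C * (1 + nsq m) ^ (-α) * Real.log (2 + norm2 m) := by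
  refine ⟨4 ^ α * 26, by positivity, fun m => ?_⟩
  set N := ⌊norm2 m / 2⌋₊ with hN
  have hm0 : 0 ≤ norm2 m := Real.sqrt_nonneg _
  have hm1 : 0 < 1 + nsq m := by linarith [nsq_nonneg' m]
  set S : Finset (ℤ × ℤ) := (Finset.range (N + 1)).biUnion (fun n => Finset.box n) with hS
  have hd : Set.PairwiseDisjoint (↑(Finset.range (N + 1)) : Set ℕ)
      (fun n => (Finset.box n : Finset (ℤ × ℤ))) := by
    intro a _ b _ hab
    refine Finset.disjoint_left.2 fun x hx hy => hab ?_
    rw [Int.mem_box] at hx hy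
    omega
  rw [tsum_eq_sum (s := S)]
  · have hA : 0 ≤ 4 ^ α * (1 + nsq m) ^ (-α) := by positivity
    have h1 : ∀ l ∈ S, Set.indicator {l : ℤ × ℤ | norm2 l ≤ norm2 m / 2}
        (fun l => (1 + nsq (m - l)) ^ (-α) * (1 + nsq l) ^ (-1 : ℝ)) l
        ≤ 4 ^ α * (1 + nsq m) ^ (-α) * (1 + nsq l)⁻¹ := by
      intro l _
      have hl : 0 ≤ (1 + nsq l)⁻¹ := inv_nonneg.2 (by linarith [nsq_nonneg' l])
      by_cases h : norm2 l ≤ norm2 m / 2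
      · rw [Set.indicator_of_mem (by exact h), Real.rpow_neg_one]
        exact mul_le_mul_of_nonneg_right (ptwise α hα m l h) hl
      · rw [Set.indicator_of_notMem (by exact h)]
        exact mul_nonneg hA hl
    refine (Finset.sum_le_sum h1).trans ?_
    rw [← Finset.mul_sum, hS, Finset.sum_biUnion hd]
    have h2 := box_sum N
    have h3 : Real.log N ≤ Real.log (2 + norm2 m) := by
      rcases Nat.eq_zero_or_pos N with h | h
      · rw [h]; simp; exact Real.log_nonneg (by linarith)
      · apply Real.log_le_log (by exact_mod_cast h)
        have := Nat.floor_le (by positivity : 0 ≤ norm2 m / 2)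
        rw [← hN] at this
        linarith
    have h4 : Real.log 2 ≤ Real.log (2 + norm2 m) :=
      Real.log_le_log (by norm_num) (by linarith)
    have h5 := Real.log_two_gt_d9
    have := mul_le_mul_of_nonneg_left
      (h2.trans (by linarith : _ ≤ 26 * Real.log (2 + norm2 m))) hA
    linarith
  · intro l hl
    apply Set.indicator_of_notMem
    intro h
    apply hl
    simp only [hS, Finset.mem_biUnion, Finset.mem_range, Int.mem_box]
    refine ⟨_, ?_, rfl⟩
    exact Nat.lt_succ_of_le (Nat.le_floor ((natAbs_le_norm2 l).trans h))
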